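/- Let d ≥ 3, let v : ℝ^d → ℝ be bounded measurable with bounded support, and let Y_x = ∫₀^∞ v(W_x(s)) ds for Brownian motion W_x started at x. Fix α ∈ ℝ. If E[e^{α Y_x}] < ∞ for some x ∈ ℝ^d, then E[e^{α Y_y}] < ∞ for every y ∈ ℝ^d, and the function y ↦ E[e^{α Y_y}] is locally bounded. -/

import Mathlib

open MeasureTheory Real Filter Topology ProbabilityTheory

noncomputable section

/-- Euclidean space `ℝ^d`. -/
abbrev Euc (d : ℕ) := EuclideanSpace ℝ (Fin d)

/-- The Brownian transition density `q(s; w) = (2πs)^{-d/2} exp(-|w|²/(2s))`. -/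
def heatKernel (d : ℕ) (s : ℝ) (w : Euc d) : ℝ :=
  (2 * π * s) ^ (-(d : ℝ) / 2) * Real.exp (-‖w‖ ^ 2 / (2 * s))

/-- Joint density of a Brownian motion started at `x`, at times `s 0 < s 1 < ⋯`. -/
def jointDensity (d : ℕ) {k : ℕ} (x : Euc d) (s : Fin k → ℝ) (z : Fin k → Euc d) : ℝ :=
  ∏ j : Fin k,
    heatKernel d (s j - if (j : ℕ) = 0 then 0 else s ⟨(j : ℕ) - 1, lt_of_le_of_lt (Nat.sub_le _ _) j.isLt⟩)
      (z j - if (j : ℕ) = 0 then x else z ⟨(j : ℕ) - 1, lt_of_le_of_lt (Nat.sub_le _ _) j.isLt⟩)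

/-- Joint density of the Brownian bridge from `a` to `b` in time `t`, at interior times `s`. -/
def bridgeDensity (d : ℕ) {k : ℕ} (t : ℝ) (a b : Euc d) (s : Fin k → ℝ) (z : Fin k → Euc d) : ℝ :=
  jointDensity d a (Fin.snoc s t) (Fin.snoc z b) / heatKernel d t (b - a)

/-- The open ordered simplex `0 < s₁ < ⋯ < s_k < t`. -/
def simplex (k : ℕ) (t : ℝ) : Set (Fin k → ℝ) :=
  {s | StrictMono s ∧ ∀ i, 0 < s i ∧ s i < t}

/-- `W` is a standard `d`-dimensional Brownian motion started at `x`, characterized by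
continuous paths and finite-dimensional densities given by products of heat kernels. -/
def IsBrownianMotion {Ω : Type*} [MeasureSpace Ω] {d : ℕ} (x : Euc d)
    (W : ℝ → Ω → Euc d) : Prop :=
  (∀ ω, W 0 ω = x) ∧ (∀ ω, Continuous fun s => W s ω) ∧
  ∀ (k : ℕ) (s : Fin (k + 1) → ℝ), StrictMono s → (∀ i, 0 < s i) →
    Measure.map (fun ω (i : Fin (k + 1)) => W (s i) ω) (ℙ : Measure Ω) =
      (volume : Measure (Fin (k + 1) → Euc d)).withDensity
        (fun z => ENNReal.ofReal (jointDensity d x s z))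

/-- `X` is a `d`-dimensional Brownian bridge from `a` to `b` in time `t`. -/
def IsBrownianBridge {Ω : Type*} [MeasureSpace Ω] {d : ℕ} (t : ℝ) (a b : Euc d)
    (X : ℝ → Ω → Euc d) : Prop :=
  (∀ ω, X 0 ω = a) ∧ (∀ ω, X t ω = b) ∧
  (∀ ω, ContinuousOn (fun s => X s ω) (Set.Icc 0 t)) ∧
  ∀ (k : ℕ) (s : Fin (k + 1) → ℝ), StrictMono s → (∀ i, 0 < s i ∧ s i < t) →
    Measure.map (fun ω (i : Fin (k + 1)) => X (s i) ω) (ℙ : Measure Ω) =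
      (volume : Measure (Fin (k + 1) → Euc d)).withDensity
        (fun z => ENNReal.ofReal (bridgeDensity d t a b s z))

/-- The path integral `∫₀^t v(X_s) ds`. -/
def pathInt {Ω : Type*} {d : ℕ} (v : Euc d → ℝ) (X : ℝ → Ω → Euc d) (t : ℝ) (ω : Ω) : ℝ :=
  ∫ s in Set.Ioc (0 : ℝ) t, v (X s ω)

/-- The total path integral `∫₀^∞ v(X_s) ds`. -/
def pathIntInf {Ω : Type*} {d : ℕ} (v : Euc d → ℝ) (X : ℝ → Ω → Euc d) (ω : Ω) : ℝ :=
  ∫ s in Set.Ioi (0 : ℝ), v (X s ω)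

/-- The density ratio `Q_{j} = q(t; y - x)/q(Δ_j s; Δ_j z)` with the conventions
`s₀ = 0`, `s_{k+1} = t`, `z₀ = x`, `z_{k+1} = y`. -/
def Qratio (d : ℕ) {k : ℕ} (t : ℝ) (x y : Euc d) (s : Fin k → ℝ) (z : Fin k → Euc d)
    (j : Fin (k + 1)) : ℝ :=
  heatKernel d t (y - x) /
    heatKernel d
      ((Fin.cons 0 (Fin.snoc s t) : Fin (k + 2) → ℝ) j.succ -
        (Fin.cons 0 (Fin.snoc s t) : Fin (k + 2) → ℝ) j.castSucc)
      ((Fin.cons x (Fin.snoc z y) : Fin (k + 2) → Euc d) j.succ -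
        (Fin.cons x (Fin.snoc z y) : Fin (k + 2) → Euc d) j.castSucc)

open scoped NNRat

/-- The value at time `t` of a path known at rational times, as a limit along rationals
decreasing to `t`. -/
def ratPathLim {d : ℕ} (w : ℚ≥0 → Euc d) (t : ℝ) : Euc d :=
  limUnder atTop fun n : ℕ => w ((⌊t * (n + 1)⌋₊ : ℚ≥0) / (n + 1))

lemma measurable_ratPathLim (d : ℕ) :
    Measurable fun p : (ℚ≥0 → Euc d) × ℝ => ratPathLim p.1 p.2 := by
  have h : ∀ n : ℕ, StronglyMeasurable fun p : (ℚ≥0 → Euc d) × ℝ =>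
      p.1 ((⌊p.2 * (n + 1)⌋₊ : ℚ≥0) / (n + 1)) := by
    intro n
    refine Measurable.stronglyMeasurable ?_
    have h1 : Measurable fun q : (ℚ≥0 → Euc d) × ℕ => q.1 ((q.2 : ℚ≥0) / (n + 1)) :=
      measurable_from_prod_countable_left fun k =>
        measurable_pi_apply (X := fun _ : ℚ≥0 => Euc d) ((k : ℚ≥0) / (n + 1))
    have h2 : Measurable fun p : (ℚ≥0 → Euc d) × ℝ => (p.1, ⌊p.2 * (n + 1)⌋₊) :=
      measurable_fst.prodMk (Nat.measurable_floor.comp (measurable_snd.mul_const _))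
    exact h1.comp h2
  exact (StronglyMeasurable.limUnder (l := atTop) h).measurable

lemma ratPathLim_eq {d : ℕ} {c : ℝ → Euc d} (hc : Continuous c) {t : ℝ} (ht : 0 ≤ t) :
    ratPathLim (fun q : ℚ≥0 => c (q : ℝ)) t = c t := by
  refine Tendsto.limUnder_eq ((hc.tendsto t).comp ?_)
  have h := (tendsto_nat_floor_mul_div_atTop (R := ℝ) ht).comp
    (tendsto_natCast_atTop_atTop.comp (tendsto_add_atTop_nat 1))
  refine h.congr fun n => ?_
  simp

/-- The exponential of the total integral of `v` along a path known at rational times. -/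
def ratPathExp {d : ℕ} (v : Euc d → ℝ) (α : ℝ) (w : ℚ≥0 → Euc d) : ENNReal :=
  ENNReal.ofReal (Real.exp (α * ∫ t in Set.Ioi (0 : ℝ), v (ratPathLim w t)))

lemma measurable_ratPathExp {d : ℕ} {v : Euc d → ℝ} (hv : Measurable v) (α : ℝ) :
    Measurable (ratPathExp v α) := by
  have h : StronglyMeasurable fun w : ℚ≥0 → Euc d =>
      ∫ t in Set.Ioi (0 : ℝ), v (ratPathLim w t) :=
    StronglyMeasurable.integral_prod_right (f := fun w t => v (ratPathLim w t))
      (hv.comp (measurable_ratPathLim d)).stronglyMeasurable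
  exact ENNReal.measurable_ofReal.comp (Real.measurable_exp.comp (h.measurable.const_mul α))

lemma ratPathExp_eq {d : ℕ} (v : Euc d → ℝ) (α : ℝ) {c : ℝ → Euc d} (hc : Continuous c) :
    ratPathExp v α (fun q : ℚ≥0 => c (q : ℝ)) =
      ENNReal.ofReal (Real.exp (α * ∫ t in Set.Ioi (0 : ℝ), v (c t))) := by
  unfold ratPathExp
  congr 3
  exact setIntegral_congr_fun measurableSet_Ioi fun t ht => by
    simp only [ratPathLim_eq hc (le_of_lt ht)]

/-- Shifting a path by time `s` changes the total integral of `v` by at most `K * s`. This holds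
also when the total integral diverges, both integrals then being `0` by convention. -/
lemma abs_integral_Ioi_sub_shift_le {d : ℕ} {v : Euc d → ℝ} (hv : Measurable v) {K : ℝ}
    (hK : ∀ z, |v z| ≤ K) {c : ℝ → Euc d} (hc : Continuous c) {s : ℝ} (hs : 0 ≤ s) :
    |(∫ t in Set.Ioi (0 : ℝ), v (c t)) - ∫ t in Set.Ioi (0 : ℝ), v (c (s + t))| ≤ K * s := by
  have hm : Measurable fun t => v (c t) := hv.comp hc.measurable
  have hshift : ∫ t in Set.Ioi (0 : ℝ), v (c (s + t)) = ∫ t in Set.Ioi s, v (c t) := by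
    rw [← (measurePreserving_add_left volume s).setIntegral_preimage_emb
      (measurableEmbedding_addLeft s) (fun t => v (c t)) (Set.Ioi s)]
    simp
  have hIoc : IntegrableOn (fun t => v (c t)) (Set.Ioc 0 s) :=
    Measure.integrableOn_of_bounded (M := K) (by simp) hm.aestronglyMeasurable
      (ae_of_all _ fun t => hK _)
  have hunion : Set.Ioc 0 s ∪ Set.Ioi s = Set.Ioi (0 : ℝ) := Set.Ioc_union_Ioi_eq_Ioi hs
  have hKs : 0 ≤ K * s := mul_nonneg ((abs_nonneg _).trans (hK 0)) hs
  rw [hshift]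
  by_cases hi : IntegrableOn (fun t => v (c t)) (Set.Ioi s)
  · rw [← hunion, setIntegral_union Set.Ioc_disjoint_Ioi_same measurableSet_Ioi hIoc hi,
      add_sub_cancel_right]
    have h := norm_setIntegral_le_of_norm_le_const (μ := volume) (s := Set.Ioc 0 s)
      (f := fun t => v (c t)) (C := K) (by simp) (fun t _ => hK _)
    simpa [hs] using h
  · have hi' : ¬ IntegrableOn (fun t => v (c t)) (Set.Ioi 0) := fun h =>
      hi (h.mono_set (Set.Ioi_subset_Ioi hs))
    rw [integral_undef hi, integral_undef hi']
    simpa using hKs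

/-- The path of `W` after time `s`, observed at rational times. -/
def shiftedRatPath {Ω : Type*} {d : ℕ} (W : ℝ → Ω → Euc d) (s : ℝ) (ω : Ω) (q : ℚ≥0) : Euc d :=
  W (s + (q : ℝ)) ω

lemma heatKernel_pos (d : ℕ) {s : ℝ} (hs : 0 < s) (w : Euc d) : 0 < heatKernel d s w := by
  unfold heatKernel
  positivity

lemma measurable_heatKernel (d : ℕ) (s : ℝ) : Measurable (heatKernel d s) := by
  unfold heatKernel
  fun_prop

lemma measurable_heatKernel_ratio (d : ℕ) (a b : ℝ) (x y : Euc d) :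
    Measurable fun z : Euc d =>
      ENNReal.ofReal (heatKernel d a (z - y) / heatKernel d b (z - x)) := by
  refine ENNReal.measurable_ofReal.comp (Measurable.div ?_ ?_)
  · exact (measurable_heatKernel d a).comp (measurable_id.sub_const y)
  · exact (measurable_heatKernel d b).comp (measurable_id.sub_const x)

lemma heatKernel_half_le (d : ℕ) (x y z : Euc d) :
    heatKernel d (1 / 2) (z - y) ≤
      2 ^ ((d : ℝ) / 2) * Real.exp (‖y - x‖ ^ 2) * heatKernel d 1 (z - x) := by
  have h1 : (2 * π * (1 / 2)) ^ (-(d : ℝ) / 2) =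
      2 ^ ((d : ℝ) / 2) * (2 * π * 1) ^ (-(d : ℝ) / 2) := by
    rw [mul_one, Real.mul_rpow zero_le_two pi_pos.le, ← mul_assoc,
      ← Real.rpow_add zero_lt_two, show (d : ℝ) / 2 + -(d : ℝ) / 2 = 0 by ring, Real.rpow_zero,
      one_mul, show 2 * π * (1 / 2) = π by ring]
  have h2 : ‖z - x‖ ^ 2 ≤ 2 * ‖z - y‖ ^ 2 + 2 * ‖y - x‖ ^ 2 := by
    have h3 : ‖z - x‖ ≤ ‖z - y‖ + ‖y - x‖ := norm_sub_le_norm_sub_add_norm_sub z y x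
    nlinarith [norm_nonneg (z - x), sq_nonneg (‖z - y‖ - ‖y - x‖)]
  have h4 : Real.exp (-‖z - y‖ ^ 2 / (2 * (1 / 2))) ≤
      Real.exp (‖y - x‖ ^ 2) * Real.exp (-‖z - x‖ ^ 2 / (2 * 1)) := by
    rw [← Real.exp_add]
    exact Real.exp_le_exp.2 (by linarith)
  unfold heatKernel
  rw [h1]
  calc _ ≤ 2 ^ ((d : ℝ) / 2) * (2 * π * 1) ^ (-(d : ℝ) / 2) *
        (Real.exp (‖y - x‖ ^ 2) * Real.exp (-‖z - x‖ ^ 2 / (2 * 1))) := by gcongr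
    _ = _ := by ring

lemma jointDensity_nonneg {d k : ℕ} (x : Euc d) {s : Fin (k + 1) → ℝ} (hs : StrictMono s)
    (hpos : ∀ i, 0 < s i) (z : Fin (k + 1) → Euc d) : 0 ≤ jointDensity d x s z := by
  refine Finset.prod_nonneg fun j _ => (heatKernel_pos d ?_ _).le
  split_ifs with hj
  · simpa using hpos j
  · refine sub_pos.2 (hs (Fin.lt_def.2 ?_))
    simp only
    omega

lemma measurable_jointDensity {d k : ℕ} (x : Euc d) (s : Fin k → ℝ) :
    Measurable (jointDensity d x s) := by
  unfold jointDensity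
  refine Finset.measurable_prod _ fun j _ => (measurable_heatKernel d _).comp ?_
  split_ifs <;> fun_prop

/-- Changing the starting point and the initial time lag of a Brownian motion affects its joint
density only through the first factor. -/
lemma jointDensity_mul_ratio {d k : ℕ} (x y : Euc d) {a b : ℝ} (hb : 0 < b)
    {t : Fin (k + 1) → ℝ} (ht : t 0 = 0) (z : Fin (k + 1) → Euc d) :
    jointDensity d x (fun i => b + t i) z *
        (heatKernel d a (z 0 - y) / heatKernel d b (z 0 - x)) =
      jointDensity d y (fun i => a + t i) z := by
  have h := (heatKernel_pos d hb (z 0 - x)).ne'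
  unfold jointDensity
  rw [Fin.prod_univ_succ, Fin.prod_univ_succ]
  simp only [Fin.val_zero, if_true, ht, add_zero, sub_zero, Fin.val_succ, Nat.add_eq_zero_iff,
    one_ne_zero, and_false, if_false, add_sub_add_left_eq_sub]
  field_simp

section Law

variable {Ω : Type*} [MeasureSpace Ω] {d : ℕ}

lemma IsBrownianMotion.aemeasurable [IsProbabilityMeasure (ℙ : Measure Ω)] {x : Euc d}
    {W : ℝ → Ω → Euc d} (hW : IsBrownianMotion x W) {s : ℝ} (hs : 0 < s) :
    AEMeasurable (W s) (ℙ : Measure Ω) := by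
  have hmap := hW.2.2 0 (fun _ => s) (Subsingleton.strictMono (α := Fin 1) _) (fun _ => hs)
  have hm : AEMeasurable (fun ω (_ : Fin 1) => W s ω) (ℙ : Measure Ω) := by
    refine AEMeasurable.of_map_ne_zero ?_
    rw [hmap, Ne, withDensity_eq_zero_iff
      (measurable_jointDensity x _).ennreal_ofReal.aemeasurable]
    intro h
    obtain ⟨z, hz⟩ := h.exists
    have hpos : 0 < jointDensity d x (fun _ : Fin 1 => s) z := by
      simpa [jointDensity] using heatKernel_pos d hs (z 0 - x)
    exact (ENNReal.ofReal_pos.2 hpos).ne' hz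
  exact aemeasurable_pi_iff.1 hm 0

lemma IsBrownianMotion.aemeasurable_shiftedRatPath [IsProbabilityMeasure (ℙ : Measure Ω)]
    {x : Euc d} {W : ℝ → Ω → Euc d} (hW : IsBrownianMotion x W) {s : ℝ} (hs : 0 < s) :
    AEMeasurable (shiftedRatPath W s) (ℙ : Measure Ω) :=
  aemeasurable_pi_iff.2 fun q => hW.aemeasurable (by positivity)

lemma IsBrownianMotion.map_shiftedRatPath_eval [IsProbabilityMeasure (ℙ : Measure Ω)]
    {x : Euc d} {W : ℝ → Ω → Euc d} (hW : IsBrownianMotion x W) {s : ℝ} (hs : 0 < s)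
    {k : ℕ} {t : Fin (k + 1) → ℚ≥0} (ht : StrictMono t) :
    ((ℙ : Measure Ω).map (shiftedRatPath W s)).map (fun w i => w (t i)) =
      (volume : Measure (Fin (k + 1) → Euc d)).withDensity
        (fun z => ENNReal.ofReal (jointDensity d x (fun i => s + (t i : ℝ)) z)) := by
  have hπ : Measurable fun (w : ℚ≥0 → Euc d) (i : Fin (k + 1)) => w (t i) := by fun_prop
  rw [AEMeasurable.map_map_of_aemeasurable hπ.aemeasurable (hW.aemeasurable_shiftedRatPath hs)]
  exact hW.2.2 k _ (fun i j hij => by simpa using ht hij) (fun i => by positivity)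

/-- The density of the law of a Brownian motion from `y` after time `a` with respect to the law
of a Brownian motion from `x` after time `b`. -/
lemma IsBrownianMotion.map_shiftedRatPath_eq_withDensity [IsProbabilityMeasure (ℙ : Measure Ω)]
    {x y : Euc d} {V W : ℝ → Ω → Euc d} (hV : IsBrownianMotion y V) (hW : IsBrownianMotion x W)
    {a b : ℝ} (ha : 0 < a) (hb : 0 < b) :
    (ℙ : Measure Ω).map (shiftedRatPath V a) =
      ((ℙ : Measure Ω).map (shiftedRatPath W b)).withDensity (fun w =>
        ENNReal.ofReal (heatKernel d a (w 0 - y) / heatKernel d b (w 0 - x))) := by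
  set μ := (ℙ : Measure Ω).map (shiftedRatPath V a)
  set ν := (ℙ : Measure Ω).map (shiftedRatPath W b)
  have hprob : IsProbabilityMeasure μ :=
    Measure.isProbabilityMeasure_map (hV.aemeasurable_shiftedRatPath ha)
  set g : Euc d → ENNReal := fun z =>
    ENNReal.ofReal (heatKernel d a (z - y) / heatKernel d b (z - x))
  have hgm : Measurable g := measurable_heatKernel_ratio d a b x y
  have key : ∀ (k : ℕ) (t : Fin (k + 1) → ℚ≥0), StrictMono t → t 0 = 0 →
      μ.map (fun w i => w (t i)) =
        (ν.withDensity fun w => g (w 0)).map (fun w i => w (t i)) := by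
    intro k t ht ht0
    have hπ : Measurable fun (w : ℚ≥0 → Euc d) (i : Fin (k + 1)) => w (t i) := by fun_prop
    have hjm := measurable_jointDensity (d := d) x (fun i => b + (t i : ℝ))
    have hstep : (ν.withDensity fun w => g (w 0)).map (fun w i => w (t i)) =
        (ν.map (fun w i => w (t i))).withDensity fun z => g (z 0) := by
      ext A hA
      rw [Measure.map_apply hπ hA, withDensity_apply _ (hπ hA), withDensity_apply _ hA,
        setLIntegral_map hA (by fun_prop) hπ]
      simp only [ht0]
    rw [hstep, hV.map_shiftedRatPath_eval ha ht, hW.map_shiftedRatPath_eval hb ht,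
      ← withDensity_mul _ (by fun_prop) (by fun_prop)]
    congr 1
    funext z
    rw [Pi.mul_apply, ← ENNReal.ofReal_mul (jointDensity_nonneg x
      (fun i j hij => by simpa using ht hij) (fun i => by positivity) z),
      jointDensity_mul_ratio x y hb (by simp [ht0])]
  have hproj : IsProjectiveLimit (ν.withDensity fun w => g (w 0))
      (fun I : Finset ℚ≥0 => μ.map I.restrict) := by
    intro I
    obtain ⟨k, hk⟩ : ∃ k, (insert 0 I : Finset ℚ≥0).card = k + 1 :=
      Nat.exists_eq_succ_of_ne_zero (by simp)
    set J : Finset ℚ≥0 := insert 0 I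
    set e := J.orderIsoOfFin hk
    have hIJ : ∀ j : I, (j : ℚ≥0) ∈ J := fun j => Finset.mem_insert_of_mem j.2
    have he0 : ((e 0 : J) : ℚ≥0) = 0 := by
      have h0 : e 0 ≤ ⟨0, Finset.mem_insert_self 0 I⟩ := by
        rw [← e.le_symm_apply]
        exact Fin.zero_le _
      exact le_antisymm h0 (zero_le)
    have hcomp : (I.restrict : (ℚ≥0 → Euc d) → _) =
        (fun (z : Fin (k + 1) → Euc d) (j : I) => z (e.symm ⟨j, hIJ j⟩)) ∘
          fun w i => w (e i : ℚ≥0) := by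
      funext w j
      simp
    simp only [hcomp]
    rw [← Measure.map_map (by fun_prop) (by fun_prop),
      ← Measure.map_map (by fun_prop) (by fun_prop),
      key k (fun i => (e i : ℚ≥0)) (fun i j hij => e.strictMono hij) he0]
  exact IsProjectiveLimit.unique (P := fun I : Finset ℚ≥0 => μ.map I.restrict)
    (fun I => rfl) hproj

/-- Harnack-type bound: exponential moments of the path integrals from two starting points are
comparable. -/
lemma lintegral_exp_pathIntInf_le [IsProbabilityMeasure (ℙ : Measure Ω)]
    {v : Euc d → ℝ} (hv : Measurable v) {K : ℝ} (hK : ∀ z, |v z| ≤ K) {x y : Euc d}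
    {V W : ℝ → Ω → Euc d} (hV : IsBrownianMotion y V) (hW : IsBrownianMotion x W) (α : ℝ) :
    (∫⁻ ω, ENNReal.ofReal (Real.exp (α * pathIntInf v V ω))) ≤
      ENNReal.ofReal (Real.exp (|α| * K * (3 / 2)) *
        (2 ^ ((d : ℝ) / 2) * Real.exp (‖y - x‖ ^ 2))) *
      ∫⁻ ω, ENNReal.ofReal (Real.exp (α * pathIntInf v W ω)) := by
  have hΦ := measurable_ratPathExp hv α
  have habs : ∀ {c : ℝ → Euc d}, Continuous c → ∀ {s : ℝ}, 0 ≤ s →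
      |α * (∫ t in Set.Ioi (0 : ℝ), v (c t)) - α * ∫ t in Set.Ioi (0 : ℝ), v (c (s + t))| ≤
        |α| * (K * s) := by
    intro c hc s hs
    rw [← mul_sub, abs_mul]
    exact mul_le_mul_of_nonneg_left (abs_integral_Ioi_sub_shift_le hv hK hc hs) (abs_nonneg α)
  have hshift : ∀ {c : ℝ → Euc d}, Continuous c → ∀ s : ℝ,
      ratPathExp v α (fun q : ℚ≥0 => c (s + (q : ℝ))) =
        ENNReal.ofReal (Real.exp (α * ∫ t in Set.Ioi (0 : ℝ), v (c (s + t)))) := by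
    intro c hc s
    exact ratPathExp_eq v α (c := fun t => c (s + t)) (by fun_prop)
  have hupper : ∀ ω, ENNReal.ofReal (Real.exp (α * pathIntInf v V ω)) ≤
      ENNReal.ofReal (Real.exp (|α| * (K * (1 / 2)))) *
        ratPathExp v α (shiftedRatPath V (1 / 2) ω) := by
    intro ω
    have h := (abs_le.1 (habs (hV.2.1 ω) (s := 1 / 2) (by norm_num))).2
    unfold shiftedRatPath
    rw [hshift (hV.2.1 ω), ← ENNReal.ofReal_mul (Real.exp_pos _).le, ← Real.exp_add]
    refine ENNReal.ofReal_le_ofReal (Real.exp_le_exp.2 ?_)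
    unfold pathIntInf
    linarith
  have hlower : ∀ ω, ratPathExp v α (shiftedRatPath W 1 ω) ≤
      ENNReal.ofReal (Real.exp (|α| * (K * 1))) *
        ENNReal.ofReal (Real.exp (α * pathIntInf v W ω)) := by
    intro ω
    have h := (abs_le.1 (habs (hW.2.1 ω) (s := 1) zero_le_one)).1
    unfold shiftedRatPath
    rw [hshift (hW.2.1 ω), ← ENNReal.ofReal_mul (Real.exp_pos _).le, ← Real.exp_add]
    refine ENNReal.ofReal_le_ofReal (Real.exp_le_exp.2 ?_)
    unfold pathIntInf
    linarith
  set C : ℝ := 2 ^ ((d : ℝ) / 2) * Real.exp (‖y - x‖ ^ 2)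
  have hC0 : 0 ≤ C := by positivity
  have hmiddle : ∫⁻ ω, ratPathExp v α (shiftedRatPath V (1 / 2) ω) ≤
      ENNReal.ofReal C * ∫⁻ ω, ratPathExp v α (shiftedRatPath W 1 ω) := by
    have hgm : Measurable fun w : ℚ≥0 → Euc d =>
        ENNReal.ofReal (heatKernel d (1 / 2) (w 0 - y) / heatKernel d 1 (w 0 - x)) :=
      (measurable_heatKernel_ratio d (1 / 2) 1 x y).comp (measurable_pi_apply 0)
    rw [← lintegral_map' hΦ.aemeasurable (hV.aemeasurable_shiftedRatPath one_half_pos),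
      ← lintegral_map' hΦ.aemeasurable (hW.aemeasurable_shiftedRatPath one_pos),
      hV.map_shiftedRatPath_eq_withDensity hW one_half_pos one_pos,
      lintegral_withDensity_eq_lintegral_mul _ hgm hΦ,
      ← lintegral_const_mul' _ _ ENNReal.ofReal_ne_top]
    refine lintegral_mono fun w => mul_le_mul_left (ENNReal.ofReal_le_ofReal ?_) _
    rw [div_le_iff₀ (heatKernel_pos d one_pos _)]
    exact heatKernel_half_le d x y (w 0)
  calc _ ≤ ∫⁻ ω, ENNReal.ofReal (Real.exp (|α| * (K * (1 / 2)))) *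
        ratPathExp v α (shiftedRatPath V (1 / 2) ω) := lintegral_mono hupper
    _ = ENNReal.ofReal (Real.exp (|α| * (K * (1 / 2)))) *
        ∫⁻ ω, ratPathExp v α (shiftedRatPath V (1 / 2) ω) :=
      lintegral_const_mul' _ _ ENNReal.ofReal_ne_top
    _ ≤ ENNReal.ofReal (Real.exp (|α| * (K * (1 / 2)))) * (ENNReal.ofReal C *
        (ENNReal.ofReal (Real.exp (|α| * (K * 1))) *
          ∫⁻ ω, ENNReal.ofReal (Real.exp (α * pathIntInf v W ω)))) := by
      gcongr
      refine hmiddle.trans ?_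
      gcongr
      exact (lintegral_mono hlower).trans_eq (lintegral_const_mul' _ _ ENNReal.ofReal_ne_top)
    _ = _ := by
      rw [← mul_assoc, ← mul_assoc, ← ENNReal.ofReal_mul (Real.exp_pos _).le,
        ← ENNReal.ofReal_mul (by positivity)]
      congr 2
      rw [mul_right_comm, ← Real.exp_add]
      congr 2
      ring

end Law

/-- Lemma 2 (finiteness dichotomy): if `E[e^{αY_x}] < ∞` for some `x`, it is finite for
every starting point, and is locally bounded as a function of the starting point. -/
theorem stmt3 (d : ℕ) (hd : 3 ≤ d) (v : Euc d → ℝ)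
    (hvm : Measurable v) (hvb : ∃ C : ℝ, ∀ z, |v z| ≤ C)
    (hvs : ∃ R : ℝ, ∀ z, v z ≠ 0 → ‖z‖ ≤ R)
    {Ω : Type*} [MeasureSpace Ω] [IsProbabilityMeasure (ℙ : Measure Ω)]
    (W : Euc d → ℝ → Ω → Euc d) (hW : ∀ x, IsBrownianMotion x (W x)) (α : ℝ)
    (x : Euc d)
    (hfin : (∫⁻ ω, ENNReal.ofReal (Real.exp (α * pathIntInf v (W x) ω))) ≠ ⊤) :
    (∀ y : Euc d, (∫⁻ ω, ENNReal.ofReal (Real.exp (α * pathIntInf v (W y) ω))) ≠ ⊤) ∧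
    (∀ y : Euc d, ∃ M : ℝ, ∀ᶠ z in 𝓝 y,
      (∫⁻ ω, ENNReal.ofReal (Real.exp (α * pathIntInf v (W z) ω))) ≤ ENNReal.ofReal M) := by
  obtain ⟨K, hK⟩ := hvb
  have hbound := fun y => lintegral_exp_pathIntInf_le hvm hK (hW y) (hW x) α
  refine ⟨fun y => ne_top_of_le_ne_top (ENNReal.mul_ne_top ENNReal.ofReal_ne_top hfin) (hbound y),
    fun y => ?_⟩
  set F := ∫⁻ ω, ENNReal.ofReal (Real.exp (α * pathIntInf v (W x) ω))
  refine ⟨Real.exp (|α| * K * (3 / 2)) *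
    (2 ^ ((d : ℝ) / 2) * Real.exp ((‖y - x‖ + 1) ^ 2)) * F.toReal, ?_⟩
  filter_upwards [Metric.ball_mem_nhds y one_pos] with z hz
  refine (hbound z).trans ?_
  rw [ENNReal.ofReal_mul (q := F.toReal) (by positivity), ENNReal.ofReal_toReal hfin]
  have hzx : ‖z - x‖ ≤ ‖y - x‖ + 1 := by
    have h1 : ‖z - x‖ ≤ ‖z - y‖ + ‖y - x‖ := norm_sub_le_norm_sub_add_norm_sub z y x
    have h2 : ‖z - y‖ < 1 := by simpa [dist_eq_norm] using hz
    linarith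
  gcongr

end
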